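/- arXiv:1108.3118 — 2 statements merged into one kernel-verified Lean document; each statement's English description precedes it below -/
import Mathlib

section
/- Let N ≥ 1, p > 1, and let ω₁, ω₂ : ℝ^N → ℝ be smooth positive functions. Suppose there exists t with p − √(p(p−1)) < t < p + √(p(p−1)) such that I_L(R) → 0 and J_L(R) → 0 as R → ∞, where I_L(R) = R^{-2(2t+p−1)/(p−1)} ∫_{R<|x|<2R} (ω₁^{p+2t−1}/ω₂^{2t})^{1/(p−1)} dx and J_L(R) = R^{-(p+2t−1)/(p−1)} ∫_{R<|x|<2R} (|∇ω₁|^{p+2t−1}/ω₂^{2t})^{1/(p−1)} dx. Then there is no positive stable sub-solution of the equation −div(ω₁ ∇u) = ω₂ u^p in ℝ^N. -/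
open MeasureTheory Filter Real
open scoped RealInnerProductSpace

noncomputable def vdiv {N : ℕ} (V : EuclideanSpace ℝ (Fin N) → EuclideanSpace ℝ (Fin N))
    (x : EuclideanSpace ℝ (Fin N)) : ℝ :=
  LinearMap.trace ℝ (EuclideanSpace ℝ (Fin N)) (fderiv ℝ V x).toLinearMap

def annulus (N : ℕ) (R : ℝ) : Set (EuclideanSpace ℝ (Fin N)) :=
  {x | R < ‖x‖ ∧ ‖x‖ < 2 * R}

section Gradient

variable {F : Type*} [NormedAddCommGroup F] [InnerProductSpace ℝ F]

theorem norm_smul_add_sq_le (a b : F) {t μ : ℝ} (h : 0 < μ * (2 * t - 1) - t ^ 2) :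
    ‖t • a + b‖ ^ 2 ≤ μ * ((2 * t - 1) * ‖a‖ ^ 2 + 2 * inner ℝ a b) +
      (1 + (μ - t) ^ 2 / (μ * (2 * t - 1) - t ^ 2)) * ‖b‖ ^ 2 := by
  set δ := μ * (2 * t - 1) - t ^ 2 with hδ
  have h1 : 0 ≤ ‖δ • a + (μ - t) • b‖ ^ 2 / δ := by positivity
  rw [norm_add_sq_real, norm_smul, norm_smul, real_inner_smul_left, real_inner_smul_right,
    mul_pow, mul_pow, Real.norm_eq_abs, Real.norm_eq_abs, sq_abs, sq_abs] at h1
  rw [norm_add_sq_real, norm_smul, real_inner_smul_left, mul_pow, Real.norm_eq_abs, sq_abs]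
  have h2 : (δ ^ 2 * ‖a‖ ^ 2 + 2 * (δ * ((μ - t) * inner ℝ a b)) + (μ - t) ^ 2 * ‖b‖ ^ 2) / δ =
      δ * ‖a‖ ^ 2 + 2 * ((μ - t) * inner ℝ a b) + (μ - t) ^ 2 / δ * ‖b‖ ^ 2 := by
    field_simp
  rw [h2] at h1
  nlinarith [h1]

variable [CompleteSpace F]

theorem gradient_rpow_mul_pow {u φ : F → ℝ} {x : F} (hu : DifferentiableAt ℝ u x)
    (hφ : DifferentiableAt ℝ φ x) (hux : 0 < u x) (r : ℝ) (k : ℕ) :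
    gradient (fun y => u y ^ r * φ y ^ k) x =
      (r * u x ^ (r - 1) * φ x ^ k) • gradient u x +
        (k * u x ^ r * φ x ^ (k - 1)) • gradient φ x := by
  have h := (hu.hasFDerivAt.rpow_const (p := r) (Or.inl hux.ne')).mul (hφ.hasFDerivAt.pow k)
  refine HasGradientAt.gradient ?_
  rw [hasGradientAt_iff_hasFDerivAt]
  refine h.congr_fderiv ?_
  ext v
  simp
  ring

theorem gradient_pow {φ : F → ℝ} {x : F} (hφ : DifferentiableAt ℝ φ x) (k : ℕ) :
    gradient (fun y => φ y ^ k) x = (k * φ x ^ (k - 1)) • gradient φ x := by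
  simpa using gradient_rpow_mul_pow (u := fun _ => (1 : ℝ)) (by fun_prop) hφ one_pos 0 k

theorem ContDiff.contDiff_gradient {f : F → ℝ} {m n : WithTop ℕ∞} (hf : ContDiff ℝ n f)
    (hmn : m + 1 ≤ n) : ContDiff ℝ m (gradient f) :=
  (InnerProductSpace.toDual ℝ F).symm.contDiff.comp (hf.fderiv_right hmn)

theorem ContDiff.continuous_gradient {f : F → ℝ} {n : WithTop ℕ∞} (hf : ContDiff ℝ n f)
    (hn : 1 ≤ n) : Continuous (gradient f) :=
  (hf.contDiff_gradient (m := 0) (by simpa using hn)).continuous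

theorem HasCompactSupport.gradient {f : F → ℝ} (hf : HasCompactSupport f) :
    HasCompactSupport (gradient f) :=
  (hf.fderiv (𝕜 := ℝ)).comp_left (map_zero (InnerProductSpace.toDual ℝ F).symm)

end Gradient

theorem integral_vdiv_mul {N : ℕ} {V : EuclideanSpace ℝ (Fin N) → EuclideanSpace ℝ (Fin N)}
    {ξ : EuclideanSpace ℝ (Fin N) → ℝ} (hV : ContDiff ℝ 1 V) (hξ : ContDiff ℝ 1 ξ)
    (hξc : HasCompactSupport ξ) :
    Integrable (fun x => vdiv V x * ξ x) ∧
      ∫ x, vdiv V x * ξ x = -∫ x, inner ℝ (V x) (gradient ξ x) := by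
  have hVd : Continuous (fderiv ℝ V) := hV.continuous_fderiv one_ne_zero
  have hξd : Continuous (fderiv ℝ ξ) := hξ.continuous_fderiv one_ne_zero
  have hVc := hV.continuous
  have hξc' := hξ.continuous
  have hVi : ∀ i x, fderiv ℝ (fun y => V y i) x (EuclideanSpace.basisFun (Fin N) ℝ i) =
      fderiv ℝ V x (EuclideanSpace.basisFun (Fin N) ℝ i) i := by
    intro i x
    have h := ((EuclideanSpace.proj (𝕜 := ℝ) i).hasFDerivAt (x := V x)).comp x
      (hV.differentiable one_ne_zero x).hasFDerivAt
    have h' : fderiv ℝ (fun y => V y i) x = _ := h.fderiv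
    rw [h']
    rfl
  have hdiv : ∀ x, vdiv V x * ξ x =
      ∑ i, fderiv ℝ (fun y => V y i) x (EuclideanSpace.basisFun (Fin N) ℝ i) * ξ x := by
    intro x
    rw [vdiv, LinearMap.trace_eq_sum_inner _ (EuclideanSpace.basisFun (Fin N) ℝ),
      Finset.sum_mul]
    refine Finset.sum_congr rfl fun i _ => ?_
    rw [hVi, EuclideanSpace.basisFun_inner]
    rfl
  have hinner : ∀ x, inner ℝ (V x) (gradient ξ x) =
      ∑ i, V x i * fderiv ℝ ξ x (EuclideanSpace.basisFun (Fin N) ℝ i) := by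
    intro x
    rw [← OrthonormalBasis.sum_inner_mul_inner (EuclideanSpace.basisFun (Fin N) ℝ)]
    refine Finset.sum_congr rfl fun i _ => ?_
    rw [EuclideanSpace.inner_basisFun_real, inner_gradient_right]
    rfl
  have hi1 : ∀ i, Integrable (fun x =>
      fderiv ℝ (fun y => V y i) x (EuclideanSpace.basisFun (Fin N) ℝ i) * ξ x) := by
    intro i
    simp only [hVi]
    exact Continuous.integrable_of_hasCompactSupport (by fun_prop) hξc.mul_left
  have hi2 : ∀ i, Integrable (fun x =>
      V x i * fderiv ℝ ξ x (EuclideanSpace.basisFun (Fin N) ℝ i)) := fun i =>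
    Continuous.integrable_of_hasCompactSupport (by fun_prop) (hξc.fderiv_apply ℝ _).mul_left
  simp only [hdiv, hinner]
  refine ⟨integrable_finsetSum _ fun i _ => hi1 i, ?_⟩
  rw [integral_finsetSum _ fun i _ => hi1 i, integral_finsetSum _ fun i _ => hi2 i,
    ← Finset.sum_neg_distrib]
  refine Finset.sum_congr rfl fun i _ => ?_
  rw [integral_mul_fderiv_eq_neg_fderiv_mul_of_integrable (hi1 i) (hi2 i), neg_neg]
  · exact Continuous.integrable_of_hasCompactSupport (by fun_prop) hξc.mul_left
  · intro x _
    have := hV.differentiable one_ne_zero x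
    fun_prop
  · exact fun x _ => hξ.differentiable one_ne_zero x

theorem stable_energy_estimate {N : ℕ} {p t μ : ℝ} {ω₁ ω₂ u φ : EuclideanSpace ℝ (Fin N) → ℝ}
    (hω₁ : ContDiff ℝ 1 ω₁) (hω₂ : Continuous ω₂) (hω₁pos : ∀ x, 0 < ω₁ x)
    (hu : ContDiff ℝ 2 u) (hupos : ∀ x, 0 < u x)
    (hsub : ∀ x, -vdiv (fun y => ω₁ y • gradient u y) x ≤ ω₂ x * u x ^ p)
    (hstab : ∀ ψ : EuclideanSpace ℝ (Fin N) → ℝ, ContDiff ℝ 2 ψ → HasCompactSupport ψ →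
      ∫ x, p * ω₂ x * u x ^ (p - 1) * ψ x ^ 2 ≤ ∫ x, ω₁ x * ‖gradient ψ x‖ ^ 2)
    (hφ : ContDiff ℝ 2 φ) (hφc : HasCompactSupport φ)
    (hμ : 0 ≤ μ) (hδ : 0 < μ * (2 * t - 1) - t ^ 2) :
    (p - μ) * ∫ x, ω₂ x * u x ^ (2 * t + p - 1) * φ x ^ 2 ≤
      (1 + (μ - t) ^ 2 / (μ * (2 * t - 1) - t ^ 2)) *
        ∫ x, ω₁ x * (u x ^ (2 * t) * ‖gradient φ x‖ ^ 2) := by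
  set C := 1 + (μ - t) ^ 2 / (μ * (2 * t - 1) - t ^ 2) with hC
  have hpow : ∀ r : ℝ, ContDiff ℝ 2 (fun x => u x ^ r) := fun r =>
    hu.rpow_const_of_ne fun x => (hupos x).ne'
  have hud : ∀ x, DifferentiableAt ℝ u x := hu.differentiable two_ne_zero
  have hφd : ∀ x, DifferentiableAt ℝ φ x := hφ.differentiable two_ne_zero
  have hφgc := hφ.continuous_gradient one_le_two
  have hugc := hu.continuous_gradient one_le_two
  have hω₁c := hω₁.continuous
  have hpc : ∀ r : ℝ, Continuous (fun x => u x ^ r) := fun r => (hpow r).continuous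
  have hφsq : HasCompactSupport (fun x => φ x ^ 2) :=
    hφc.comp_left (g := fun y : ℝ => y ^ 2) (by simp)
  set ξ : EuclideanSpace ℝ (Fin N) → ℝ := fun y => u y ^ (2 * t - 1) * φ y ^ 2 with hξ
  have hξ2 : ContDiff ℝ 2 ξ := (hpow _).mul (hφ.pow 2)
  have hξc : HasCompactSupport ξ := hφsq.mul_left
  have hξg := hξ2.continuous_gradient one_le_two
  have hV : ContDiff ℝ 1 (fun y => ω₁ y • gradient u y) :=
    hω₁.smul (hu.contDiff_gradient (by norm_num))
  obtain ⟨hint, hdiv⟩ := integral_vdiv_mul hV (hξ2.of_le one_le_two) hξc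
  have hB : Integrable (fun x => ω₂ x * u x ^ (2 * t + p - 1) * φ x ^ 2) :=
    Continuous.integrable_of_hasCompactSupport
      ((hω₂.mul (hpc _)).mul (hφ.continuous.pow 2)) hφsq.mul_left
  have hA : Integrable (fun x => inner ℝ (ω₁ x • gradient u x) (gradient ξ x)) :=
    Continuous.integrable_of_hasCompactSupport (by fun_prop)
      (hξc.gradient.mono fun x hx h0 => hx (by simp only [h0, inner_zero_right]))
  have hD : Integrable (fun x => ω₁ x * (u x ^ (2 * t) * ‖gradient φ x‖ ^ 2)) :=
    Continuous.integrable_of_hasCompactSupport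
      (hω₁c.mul ((hpc _).mul (hφgc.norm.pow 2)))
      (hφc.gradient.mono fun x hx h0 => hx (by simp [h0]))
  have hweak : ∫ x, inner ℝ (ω₁ x • gradient u x) (gradient ξ x) ≤
      ∫ x, ω₂ x * u x ^ (2 * t + p - 1) * φ x ^ 2 := by
    rw [← neg_neg (∫ x, inner ℝ (ω₁ x • gradient u x) (gradient ξ x)), ← hdiv, ← integral_neg]
    refine integral_mono hint.neg hB fun x => ?_
    have hξ0 : 0 ≤ ξ x := mul_nonneg (Real.rpow_nonneg (hupos x).le _) (sq_nonneg _)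
    have h1 := mul_le_mul_of_nonneg_right (hsub x) hξ0
    have h2 : u x ^ (2 * t + p - 1) = u x ^ p * u x ^ (2 * t - 1) := by
      rw [← Real.rpow_add (hupos x)]; ring_nf
    simp only [h2, hξ] at h1 ⊢
    linarith
  have hψc : HasCompactSupport (fun y => u y ^ t * φ y ^ 1) := by
    simp only [pow_one]
    exact hφc.mul_left
  have hψ2 : ContDiff ℝ 2 (fun y => u y ^ t * φ y ^ 1) := (hpow _).mul (hφ.pow 1)
  have hst := hstab _ hψ2 hψc
  have hleft : ∫ x, p * ω₂ x * u x ^ (p - 1) * (u x ^ t * φ x ^ 1) ^ 2 =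
      p * ∫ x, ω₂ x * u x ^ (2 * t + p - 1) * φ x ^ 2 := by
    rw [← integral_const_mul]
    refine integral_congr_ae (.of_forall fun x => ?_)
    have h2 : u x ^ (2 * t + p - 1) = u x ^ (p - 1) * (u x ^ t) ^ 2 := by
      rw [← Real.rpow_natCast, ← Real.rpow_mul (hupos x).le, ← Real.rpow_add (hupos x)]
      push_cast
      ring_nf
    simp only [h2]
    ring
  have hright : ∫ x, ω₁ x * ‖gradient (fun y => u y ^ t * φ y ^ 1) x‖ ^ 2 ≤
      ∫ x, (μ * inner ℝ (ω₁ x • gradient u x) (gradient ξ x) +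
        C * (ω₁ x * (u x ^ (2 * t) * ‖gradient φ x‖ ^ 2))) := by
    refine integral_mono_of_nonneg
      (.of_forall fun x => mul_nonneg (hω₁pos x).le (sq_nonneg _))
      ((hA.const_mul _).add (hD.const_mul _)) (.of_forall fun x => ?_)
    have hq := norm_smul_add_sq_le ((u x ^ (t - 1) * φ x) • gradient u x)
      (u x ^ t • gradient φ x) hδ
    rw [← hC] at hq
    have e1 : gradient (fun y => u y ^ t * φ y ^ 1) x =
        t • ((u x ^ (t - 1) * φ x) • gradient u x) + u x ^ t • gradient φ x := by
      rw [gradient_rpow_mul_pow (hud x) (hφd x) (hupos x), smul_smul]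
      simp [mul_assoc]
    have e2 : gradient ξ x = ((2 * t - 1) * u x ^ (2 * t - 1 - 1) * φ x ^ 2) • gradient u x +
        (2 * u x ^ (2 * t - 1) * φ x) • gradient φ x := by
      rw [hξ, gradient_rpow_mul_pow (hud x) (hφd x) (hupos x)]
      simp
    have h1 : u x ^ (2 * t - 1 - 1) = (u x ^ (t - 1)) ^ 2 := by
      rw [← Real.rpow_natCast, ← Real.rpow_mul (hupos x).le]
      push_cast
      ring_nf
    have h2 : u x ^ (2 * t - 1) = u x ^ (t - 1) * u x ^ t := by
      rw [← Real.rpow_add (hupos x)]; ring_nf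
    have h3 : u x ^ (2 * t) = (u x ^ t) ^ 2 := by
      rw [← Real.rpow_natCast, ← Real.rpow_mul (hupos x).le]
      push_cast
      ring_nf
    have h4 := mul_le_mul_of_nonneg_left hq (hω₁pos x).le
    simp only [norm_smul, mul_pow, real_inner_smul_left, real_inner_smul_right,
      Real.norm_eq_abs, sq_abs] at h4
    simp only [e1, e2, h1, h2, h3, inner_add_right, real_inner_smul_left,
      real_inner_smul_right, real_inner_self_eq_norm_sq]
    linarith
  rw [integral_add (hA.const_mul _) (hD.const_mul _), integral_const_mul,
    integral_const_mul] at hright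
  have := mul_le_mul_of_nonneg_left hweak hμ
  simp only [hleft] at hst
  linarith

theorem young_weighted {p t a b u η g K : ℝ} (hp : 1 < p) (ht : 0 < t) (ha : 0 < a) (hb : 0 < b)
    (hu : 0 < u) (hη0 : 0 ≤ η) (hη1 : η ≤ 1) (hg : 0 ≤ g) (hK : 0 ≤ K) {m : ℕ}
    (hm : (2 * t + p - 1) / (p - 1) ≤ m) :
    K * (a * (u ^ (2 * t) * (m * η ^ (m - 1) * g) ^ 2)) ≤
      b * u ^ (2 * t + p - 1) * (η ^ m) ^ 2 / ((2 * t + p - 1) / (2 * t)) +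
        (K * m ^ 2) ^ ((2 * t + p - 1) / (p - 1)) *
          ((a ^ (p + 2 * t - 1) / b ^ (2 * t)) ^ (1 / (p - 1)) *
            g ^ (2 * ((2 * t + p - 1) / (p - 1)))) := by
  have hp1 : 0 < p - 1 := by linarith
  have hT : 0 < 2 * t + p - 1 := by linarith
  set s := (2 * t + p - 1) / (p - 1) with hs
  set q := (2 * t + p - 1) / (2 * t) with hq
  have hs1 : 1 < s := by rw [hs, lt_div_iff₀ hp1]; linarith
  have hqs : q.HolderConjugate s := by
    rw [Real.holderConjugate_iff, hq, lt_div_iff₀ (by positivity)]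
    refine ⟨by linarith, ?_⟩
    rw [hs]
    field_simp
    ring
  have hq0 : 0 < q := hqs.pos
  have hs0 : 0 < s := by linarith
  have hm1 : 1 ≤ m := by
    have : (1 : ℝ) ≤ m := hs1.le.trans hm
    exact_mod_cast this
  have hy := Real.young_inequality_of_nonneg
    (a := b ^ (1 / q) * u ^ (2 * t) * (η ^ (m - 1)) ^ 2) (b := K * m ^ 2 * (a / b ^ (1 / q) * g ^ 2))
    (by positivity) (by positivity) hqs
  have hb' : b ^ (1 / q) ≠ 0 := by positivity
  have e0 : K * (a * (u ^ (2 * t) * (m * η ^ (m - 1) * g) ^ 2)) =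
      b ^ (1 / q) * u ^ (2 * t) * (η ^ (m - 1)) ^ 2 * (K * m ^ 2 * (a / b ^ (1 / q) * g ^ 2)) := by
    field_simp
  rw [e0]
  refine hy.trans (add_le_add ?_ ?_)
  · refine div_le_div_of_nonneg_right ?_ hq0.le
    rw [Real.mul_rpow (by positivity) (by positivity), Real.mul_rpow (by positivity)
      (by positivity), ← Real.rpow_mul hb.le, ← Real.rpow_mul hu.le, one_div_mul_cancel hq0.ne',
      Real.rpow_one]
    have e1 : 2 * t * q = 2 * t + p - 1 := by rw [hq]; field_simp
    rw [e1]
    refine mul_le_mul_of_nonneg_left ?_ (by positivity)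
    rcases hη0.eq_or_lt with h0 | h0
    · have hm2 : (2:ℕ) ≤ m := by
        have : (1 : ℝ) < m := hs1.trans_le hm
        exact_mod_cast this
      rw [← h0, zero_pow (by omega), zero_pow two_ne_zero, Real.zero_rpow hq0.ne']
      positivity
    · rw [← pow_mul, ← pow_mul, ← Real.rpow_natCast, ← Real.rpow_natCast η (m * 2),
        ← Real.rpow_mul h0.le]
      refine Real.rpow_le_rpow_of_exponent_ge h0 hη1 ?_
      push_cast [Nat.cast_sub hm1]
      rw [hq, mul_div_assoc', le_div_iff₀ (by positivity)]
      rw [hs, div_le_iff₀ hp1] at hm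
      nlinarith
  · have e2 : (p + 2 * t - 1) * (1 / (p - 1)) = s := by rw [hs]; ring
    have e3 : 2 * t * (1 / (p - 1)) = 1 / q * s := by rw [hs, hq]; field_simp
    have e4 : (g ^ 2) ^ s = g ^ (2 * s) := by
      rw [← Real.rpow_natCast, ← Real.rpow_mul hg, Nat.cast_ofNat]
    rw [Real.mul_rpow (x := K * m ^ 2) (by positivity) (by positivity),
      Real.mul_rpow (x := a / b ^ (1 / q)) (by positivity) (by positivity),
      Real.div_rpow ha.le (by positivity),
      Real.div_rpow (x := a ^ (p + 2 * t - 1)) (by positivity) (by positivity),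
      ← Real.rpow_mul hb.le, ← Real.rpow_mul ha.le, ← Real.rpow_mul hb.le, e2, e3, e4]
    exact div_le_self (by positivity) hs1.le

theorem exists_cutoff (N : ℕ) : ∃ M : ℝ, 0 ≤ M ∧ ∀ R : ℝ, 0 < R →
    ∃ η : EuclideanSpace ℝ (Fin N) → ℝ, ContDiff ℝ 2 η ∧ HasCompactSupport η ∧
      (∀ x, 0 ≤ η x) ∧ (∀ x, η x ≤ 1) ∧ (∀ x, ‖x‖ ≤ R → η x = 1) ∧
      (∀ x, 2 * R ≤ ‖x‖ → η x = 0) ∧ (∀ x, ‖gradient η x‖ ≤ M / R) ∧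
      ∀ x, x ∉ annulus N R → gradient η x = 0 := by
  let χ : ContDiffBump (0 : EuclideanSpace ℝ (Fin N)) := ⟨1, 2, one_pos, one_lt_two⟩
  have hχ : ContDiff ℝ 2 χ := χ.contDiff
  obtain ⟨M, hM⟩ := χ.hasCompactSupport.gradient.exists_bound_of_continuous
    (hχ.continuous_gradient one_le_two)
  refine ⟨M, (norm_nonneg _).trans (hM 0), fun R hR => ?_⟩
  have hnorm : ∀ x : EuclideanSpace ℝ (Fin N), ‖R⁻¹ • x‖ = ‖x‖ / R := fun x => by
    rw [norm_smul, Real.norm_of_nonneg (inv_nonneg.2 hR.le), div_eq_inv_mul]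
  set η : EuclideanSpace ℝ (Fin N) → ℝ := fun x => χ (R⁻¹ • x) with hη
  have hη2 : ContDiff ℝ 2 η := hχ.comp (contDiff_const_smul _)
  have h0 : ∀ x, 0 ≤ η x := fun x => χ.nonneg
  have h1 : ∀ x, η x ≤ 1 := fun x => χ.le_one
  have hone : ∀ x, ‖x‖ ≤ R → η x = 1 := fun x hx => by
    refine χ.one_of_mem_closedBall ?_
    rw [mem_closedBall_zero_iff, hnorm]
    exact (div_le_one hR).2 hx
  have hzero : ∀ x, 2 * R ≤ ‖x‖ → η x = 0 := fun x hx => by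
    refine χ.zero_of_le_dist ?_
    rw [dist_zero_right, hnorm]
    exact (le_div_iff₀ hR).2 hx
  refine ⟨η, hη2, ?_, h0, h1, hone, hzero, fun x => ?_, fun x hx => ?_⟩
  · refine HasCompactSupport.intro (isCompact_closedBall 0 (2 * R)) fun x hx => hzero x ?_
    rw [mem_closedBall_zero_iff, not_le] at hx
    exact hx.le
  · have hg : gradient η x = R⁻¹ • gradient χ (R⁻¹ • x) := by
      refine HasGradientAt.gradient ?_
      rw [hasGradientAt_iff_hasFDerivAt]
      have h := (hχ.differentiable two_ne_zero (R⁻¹ • x)).hasFDerivAt.comp x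
        ((hasFDerivAt_id x).const_smul R⁻¹)
      refine h.congr_fderiv ?_
      ext v
      simp
    rw [hg, norm_smul, Real.norm_of_nonneg (inv_nonneg.2 hR.le), div_eq_inv_mul]
    exact mul_le_mul_of_nonneg_left (hM _) (inv_nonneg.2 hR.le)
  · have hd : fderiv ℝ η x = 0 := by
      by_cases hxR : ‖x‖ ≤ R
      · refine IsLocalMax.fderiv_eq_zero (.of_forall fun y => ?_)
        rw [hone x hxR]
        exact h1 y
      · refine IsLocalMin.fderiv_eq_zero (.of_forall fun y => ?_)
        rw [hzero x (not_lt.1 fun h => hx ⟨not_le.1 hxR, h⟩)]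
        exact h0 y
    rw [gradient, hd, map_zero]

theorem half_lt_and_sq_lt {p t : ℝ} (hp : 1 < p) (ht1 : p - √(p * (p - 1)) < t)
    (ht2 : t < p + √(p * (p - 1))) : 1 / 2 < t ∧ t ^ 2 < p * (2 * t - 1) := by
  have hsq := Real.sq_sqrt (mul_nonneg (by linarith) (by linarith) : 0 ≤ p * (p - 1))
  have h0 := Real.sqrt_nonneg (p * (p - 1))
  constructor
  · have : √(p * (p - 1)) < p - 1 / 2 := lt_of_pow_lt_pow_left₀ 2 (by linarith) (by linarith)
    linarith
  · have := sq_lt_sq' (show -√(p * (p - 1)) < t - p by linarith) (by linarith)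
    linarith

theorem stmt_1 (N : ℕ) (hN : 1 ≤ N) (p : ℝ) (hp : 1 < p)
    (ω₁ ω₂ : EuclideanSpace ℝ (Fin N) → ℝ)
    (hω₁ : ContDiff ℝ (⊤ : ℕ∞) ω₁) (hω₂ : ContDiff ℝ (⊤ : ℕ∞) ω₂)
    (hω₁pos : ∀ x, 0 < ω₁ x) (hω₂pos : ∀ x, 0 < ω₂ x)
    (t : ℝ) (ht1 : p - Real.sqrt (p * (p - 1)) < t) (ht2 : t < p + Real.sqrt (p * (p - 1)))
    (hIL : Tendsto (fun R : ℝ =>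
      R ^ (-2*(2*t + p - 1)/(p - 1)) *
        ∫ x in annulus N R, (ω₁ x ^ (p + 2*t - 1) / ω₂ x ^ (2*t)) ^ (1/(p - 1)))
      atTop (nhds 0))
    (hJL : Tendsto (fun R : ℝ =>
      R ^ (-(p + 2*t - 1)/(p - 1)) *
        ∫ x in annulus N R, (‖gradient ω₁ x‖ ^ (p + 2*t - 1) / ω₂ x ^ (2*t)) ^ (1/(p - 1)))
      atTop (nhds 0)) :
    ¬ ∃ u : EuclideanSpace ℝ (Fin N) → ℝ, ContDiff ℝ 2 u ∧ (∀ x, 0 < u x) ∧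
      (∀ x, -vdiv (fun y => ω₁ y • gradient u y) x ≤ ω₂ x * u x ^ p) ∧
      (∀ ψ : EuclideanSpace ℝ (Fin N) → ℝ, ContDiff ℝ 2 ψ → HasCompactSupport ψ →
        ∫ x, p * ω₂ x * u x ^ (p - 1) * ψ x ^ 2 ≤ ∫ x, ω₁ x * ‖gradient ψ x‖ ^ 2) := by
  rintro ⟨u, hu, hupos, hsub, hstab⟩
  obtain ⟨ht, htp⟩ := half_lt_and_sq_lt hp ht1 ht2
  have hp1 : 0 < p - 1 := by linarith
  have h2t : 0 < 2 * t - 1 := by linarith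
  obtain ⟨μ, hμ1, hμ2⟩ := exists_between ((div_lt_iff₀ h2t).2 htp)
  have hμ0 : 0 ≤ μ := le_trans (by positivity) hμ1.le
  have hδ : 0 < μ * (2 * t - 1) - t ^ 2 := sub_pos.2 ((div_lt_iff₀ h2t).1 hμ1)
  have hpμ : 0 < p - μ := sub_pos.2 hμ2
  set K := (1 + (μ - t) ^ 2 / (μ * (2 * t - 1) - t ^ 2)) / (p - μ) with hK
  have hK0 : 0 ≤ K := by positivity
  set s := (2 * t + p - 1) / (p - 1) with hs
  set q := (2 * t + p - 1) / (2 * t) with hq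
  have hq1 : 1 < q := by
    rw [hq, lt_div_iff₀ (by linarith)]
    linarith
  obtain ⟨m, hm⟩ := exists_nat_ge s
  obtain ⟨M, hM0, hcut⟩ := exists_cutoff N
  set F : EuclideanSpace ℝ (Fin N) → ℝ := fun x =>
    (ω₁ x ^ (p + 2 * t - 1) / ω₂ x ^ (2 * t)) ^ (1 / (p - 1)) with hF
  have hω₁c := hω₁.continuous
  have hω₂c := hω₂.continuous
  have hbase : ∀ x, 0 < ω₁ x ^ (p + 2 * t - 1) / ω₂ x ^ (2 * t) := fun x =>
    div_pos (Real.rpow_pos_of_pos (hω₁pos x) _) (Real.rpow_pos_of_pos (hω₂pos x) _)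
  have hF0 : ∀ x, 0 ≤ F x := fun x => Real.rpow_nonneg (hbase x).le _
  have hFc : Continuous F :=
    ((hω₁c.rpow_const fun x => .inl (hω₁pos x).ne').div
      (hω₂c.rpow_const fun x => .inl (hω₂pos x).ne')
      fun x => (Real.rpow_pos_of_pos (hω₂pos x) _).ne').rpow_const fun x => .inl (hbase x).ne'
  have hFint : ∀ R, IntegrableOn F (annulus N R) := fun R =>
    (hFc.continuousOn.integrableOn_compact (isCompact_closedBall 0 (2 * R))).mono_set
      fun x hx => mem_closedBall_zero_iff.2 hx.2.le
  have hannulus : ∀ R, MeasurableSet (annulus N R) := fun R =>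
    ((isOpen_lt continuous_const continuous_norm).inter
      (isOpen_lt continuous_norm continuous_const)).measurableSet
  set T := 2 * t + p - 1 with hT
  have hWc : Continuous fun x => ω₂ x * u x ^ T :=
    hω₂c.mul (hu.continuous.rpow_const fun x => .inl (hupos x).ne')
  have hWpos : ∀ x, 0 < ω₂ x * u x ^ T := fun x =>
    mul_pos (hω₂pos x) (Real.rpow_pos_of_pos (hupos x) _)
  have hWint : ∀ φ : EuclideanSpace ℝ (Fin N) → ℝ, Continuous φ → HasCompactSupport φ →
      Integrable fun x => ω₂ x * u x ^ T * φ x ^ 2 := by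
    intro φ hφ hφc
    have hφsq : HasCompactSupport fun x => φ x ^ 2 :=
      hφc.comp_left (g := fun y : ℝ => y ^ 2) (by simp)
    exact (hWc.mul (hφ.pow 2)).integrable_of_hasCompactSupport hφsq.mul_left
  obtain ⟨η₁, hη₁, hη₁c, hη₁nonneg, hη₁le, hη₁one, hη₁zero, -, -⟩ := hcut 1 one_pos
  have hc : 0 < ∫ x, ω₂ x * u x ^ T * η₁ x ^ 2 := by
    refine integral_pos_of_integrable_nonneg_nonzero (x := 0) (hWc.mul (hη₁.continuous.pow 2))
      (hWint _ hη₁.continuous hη₁c) (fun x => mul_nonneg (hWpos x).le (sq_nonneg _)) ?_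
    rw [hη₁one 0 (by simp)]
    simpa using (hWpos 0).ne'
  have key : ∀ R : ℝ, 2 ≤ R → (∫ x, ω₂ x * u x ^ T * η₁ x ^ 2) * (1 - 1 / q) ≤
      (K * m ^ 2) ^ s * M ^ (2 * s) *
        (R ^ (-2 * T / (p - 1)) * ∫ x in annulus N R, F x) := by
    intro R hR
    have hR0 : 0 < R := by linarith
    obtain ⟨η, hη, hηc, hη0, hηle, hηone, -, hηgrad, hηout⟩ := hcut R hR0
    have hm0 : m ≠ 0 := by
      rintro rfl
      have : 0 < s := by rw [hs]; exact div_pos (by linarith) hp1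
      norm_num at hm
      linarith
    have hφc : HasCompactSupport fun x => η x ^ m :=
      hηc.comp_left (g := fun y : ℝ => y ^ m) (by simp [hm0])
    have hφ : ContDiff ℝ 2 fun x => η x ^ m := hη.pow m
    have hBint := hWint _ hφ.continuous hφc
    have henergy := stable_energy_estimate (hω₁.of_le (by simp)) hω₂c hω₁pos hu hupos hsub hstab
      hφ hφc hμ0 hδ
    have hlow : ∫ x, ω₂ x * u x ^ T * η₁ x ^ 2 ≤ ∫ x, ω₂ x * u x ^ T * (η x ^ m) ^ 2 := by
      refine integral_mono (hWint _ hη₁.continuous hη₁c) hBint fun x => ?_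
      refine mul_le_mul_of_nonneg_left ?_ (hWpos x).le
      rcases le_total ‖x‖ 2 with hx | hx
      · rw [hηone x (hx.trans hR), one_pow, one_pow]
        exact pow_le_one₀ (hη₁nonneg x) (hη₁le x)
      · rw [hη₁zero x (by linarith), zero_pow two_ne_zero]
        exact sq_nonneg _
    have hGint : Integrable ((annulus N R).indicator fun x => F x * (M / R) ^ (2 * s)) :=
      IntegrableOn.integrable_indicator ((hFint R).mul_const _) (hannulus R)
    have hup : ∫ x, K * (ω₁ x * (u x ^ (2 * t) * ‖gradient (fun y => η y ^ m) x‖ ^ 2)) ≤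
        ∫ x, (ω₂ x * u x ^ T * (η x ^ m) ^ 2 / q + (K * m ^ 2) ^ s *
          (annulus N R).indicator (fun x => F x * (M / R) ^ (2 * s)) x) := by
      refine integral_mono_of_nonneg (.of_forall fun x => ?_)
        ((hBint.div_const _).add (hGint.const_mul _)) (.of_forall fun x => ?_)
      · exact mul_nonneg hK0 (mul_nonneg (hω₁pos x).le
          (mul_nonneg (Real.rpow_nonneg (hupos x).le _) (sq_nonneg _)))
      · have hy := young_weighted hp (by linarith) (hω₁pos x) (hω₂pos x) (hupos x) (hη0 x)
          (hηle x) (norm_nonneg (gradient η x)) hK0 hm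
        have hn : ‖gradient (fun y => η y ^ m) x‖ ^ 2 =
            (m * η x ^ (m - 1) * ‖gradient η x‖) ^ 2 := by
          rw [gradient_pow (hη.differentiable two_ne_zero x), norm_smul, mul_pow, mul_pow,
            Real.norm_eq_abs, sq_abs]
        simp only [hn]
        refine hy.trans (add_le_add le_rfl (mul_le_mul_of_nonneg_left ?_ (by positivity)))
        have hs0 : 0 < 2 * s := by
          rw [hs]
          exact mul_pos two_pos (div_pos (by linarith) hp1)
        by_cases hx : x ∈ annulus N R
        · rw [Set.indicator_of_mem hx]
          exact mul_le_mul_of_nonneg_left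
            (Real.rpow_le_rpow (norm_nonneg _) (hηgrad x) hs0.le) (hF0 x)
        · rw [Set.indicator_of_notMem hx, hηout x hx, norm_zero, Real.zero_rpow hs0.ne', mul_zero]
    rw [integral_const_mul, integral_add (hBint.div_const _) (hGint.const_mul _),
      integral_div, integral_const_mul, integral_indicator (hannulus R), integral_mul_const,
      hK, div_mul_eq_mul_div, div_le_iff₀ hpμ, ← hK] at hup
    have hBle := le_of_mul_le_mul_left ((henergy.trans hup).trans_eq (mul_comm _ _)) hpμ
    have hMR : (M / R) ^ (2 * s) = M ^ (2 * s) * R ^ (-2 * T / (p - 1)) := by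
      rw [Real.div_rpow hM0 hR0.le, div_eq_mul_inv, ← Real.rpow_neg hR0.le]
      congr 2
      rw [hs]
      ring
    have hq2 : 0 ≤ 1 - 1 / q := by
      rw [sub_nonneg]
      exact (div_le_one (by linarith)).2 hq1.le
    calc _ ≤ (∫ x, ω₂ x * u x ^ T * (η x ^ m) ^ 2) * (1 - 1 / q) :=
          mul_le_mul_of_nonneg_right hlow hq2
      _ ≤ (K * m ^ 2) ^ s * ((∫ x in annulus N R, F x) * (M / R) ^ (2 * s)) := by
          rw [mul_sub, mul_one, mul_one_div]
          linarith
      _ = _ := by rw [hMR]; ring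
  have hlim := hIL.const_mul ((K * m ^ 2) ^ s * M ^ (2 * s))
  rw [mul_zero] at hlim
  have hle := ge_of_tendsto hlim ((eventually_ge_atTop 2).mono key)
  have hq3 : 0 < 1 - 1 / q := by
    rw [sub_pos]
    exact (div_lt_one (by linarith)).2 hq1
  exact (mul_pos hc hq3).not_ge hle
end

section
/- Let N ≥ 1 and let ω₁, ω₂ : ℝ^N → ℝ be smooth positive functions with ∇ω₁(x) · x ≤ 0 for all x with |x| sufficiently large. Suppose there exists t with 0 < t < 2 such that I_G(R) → 0 as R → ∞, where I_G(R) = R^{-4t-2} ∫_{R<|x|<2R} ω₁^{2t+1}/ω₂^{2t} dx. Then there is no stable sub-solution of the equation −div(ω₁ ∇u) = ω₂ e^u in ℝ^N. -/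
open MeasureTheory Filter Real
open scoped RealInnerProductSpace

section Divergence

variable {N : ℕ}

lemma vdiv_eq_sum (V : EuclideanSpace ℝ (Fin N) → EuclideanSpace ℝ (Fin N))
    (hV : Differentiable ℝ V) (x : EuclideanSpace ℝ (Fin N)) :
    vdiv V x = ∑ i, fderiv ℝ (fun y => V y i) x (EuclideanSpace.single i 1) := by
  unfold vdiv
  rw [LinearMap.trace_eq_sum_inner _ (EuclideanSpace.basisFun (Fin N) ℝ)]
  refine Finset.sum_congr rfl fun i _ => ?_
  have h : HasFDerivAt (fun y => V y i)
      ((EuclideanSpace.proj i : EuclideanSpace ℝ (Fin N) →L[ℝ] ℝ).comp (fderiv ℝ V x)) x :=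
    (EuclideanSpace.proj i : EuclideanSpace ℝ (Fin N) →L[ℝ] ℝ).hasFDerivAt.comp x
      (hV x).hasFDerivAt
  rw [h.fderiv]
  simp [EuclideanSpace.inner_single_left]

lemma vdiv_smul {f : EuclideanSpace ℝ (Fin N) → ℝ}
    {W : EuclideanSpace ℝ (Fin N) → EuclideanSpace ℝ (Fin N)} {x : EuclideanSpace ℝ (Fin N)}
    (hf : DifferentiableAt ℝ f x) (hW : DifferentiableAt ℝ W x) :
    vdiv (fun y => f y • W y) x = f x * vdiv W x + fderiv ℝ f x (W x) := by
  unfold vdiv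
  rw [fderiv_fun_smul hf hW]
  have : ((f x • fderiv ℝ W x + (fderiv ℝ f x).smulRight (W x) :
      EuclideanSpace ℝ (Fin N) →L[ℝ] EuclideanSpace ℝ (Fin N))).toLinearMap
      = f x • (fderiv ℝ W x).toLinearMap
        + LinearMap.smulRight (fderiv ℝ f x).toLinearMap (W x) := rfl
  rw [this, map_add, map_smul, LinearMap.trace_smulRight]
  simp

lemma vdiv_id (x : EuclideanSpace ℝ (Fin N)) : vdiv (fun y => y) x = N := by
  unfold vdiv
  rw [fderiv_fun_id]
  have : (ContinuousLinearMap.id ℝ (EuclideanSpace ℝ (Fin N))).toLinearMap = LinearMap.id := rfl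
  rw [this, LinearMap.trace_id]
  simp

lemma integrable_integral_vdiv_eq_zero
    {V : EuclideanSpace ℝ (Fin N) → EuclideanSpace ℝ (Fin N)}
    (hV : ContDiff ℝ 1 V) (hc : HasCompactSupport V) :
    Integrable (vdiv V) ∧ ∫ x, vdiv V x = 0 := by
  have hVi : ∀ i, ContDiff ℝ 1 (fun y => V y i) := contDiff_euclidean.1 hV
  have hci : ∀ i, HasCompactSupport (fun y => V y i) := fun i =>
    hc.comp_left (g := fun v : EuclideanSpace ℝ (Fin N) => v i) rfl
  have hint : ∀ i, Integrable
      (fun x => fderiv ℝ (fun y => V y i) x (EuclideanSpace.single i 1)) := fun i =>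
    (((hVi i).continuous_fderiv one_ne_zero).clm_apply
      continuous_const).integrable_of_hasCompactSupport ((hci i).fderiv_apply ℝ _)
  have heq : vdiv V =
      fun x => ∑ i, fderiv ℝ (fun y => V y i) x (EuclideanSpace.single i 1) :=
    funext (vdiv_eq_sum V (hV.differentiable one_ne_zero))
  rw [heq]
  refine ⟨integrable_finsetSum _ fun i _ => hint i, ?_⟩
  rw [integral_finsetSum _ fun i _ => hint i]
  refine Finset.sum_eq_zero fun i _ => ?_
  have := integral_mul_fderiv_eq_neg_fderiv_mul_of_integrable (μ := volume)
    (f := fun _ : EuclideanSpace ℝ (Fin N) => (1 : ℝ)) (g := fun y => V y i)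
    (v := EuclideanSpace.single i 1) (by simp) (by simpa using hint i)
    (by simpa using (hVi i).continuous.integrable_of_hasCompactSupport (hci i))
    (fun x _ => differentiableAt_const _)
    (fun x _ => (hVi i).differentiable one_ne_zero x)
  simpa using this

lemma contDiff_one_gradient {u : EuclideanSpace ℝ (Fin N) → ℝ} (hu : ContDiff ℝ 2 u) :
    ContDiff ℝ 1 (gradient u) := by
  rw [contDiff_euclidean]
  intro i
  have : (fun x => gradient u x i) = fun x => fderiv ℝ u x (EuclideanSpace.single i 1) := by
    funext x
    rw [← inner_gradient_left]
    simp [EuclideanSpace.inner_single_right, -inner_gradient_left]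
  rw [this]
  exact (hu.fderiv_right (m := 1) (by norm_num)).clm_apply contDiff_const

/-- The weighted Dirichlet energy density of a compactly supported `C¹` function is integrable. -/
lemma integrable_mul_norm_gradient_sq {w ψ : EuclideanSpace ℝ (Fin N) → ℝ} (hw : Continuous w)
    (hψ : ContDiff ℝ 1 ψ) (hψs : HasCompactSupport ψ) :
    Integrable fun x => w x * ‖gradient ψ x‖ ^ 2 := by
  have heq : (fun x => w x * ‖gradient ψ x‖ ^ 2) = fun x => w x * ‖fderiv ℝ ψ x‖ ^ 2 := by
    funext x
    rw [gradient, LinearIsometryEquiv.norm_map]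
  rw [heq]
  refine (hw.mul ((hψ.continuous_fderiv one_ne_zero).norm.pow 2)).integrable_of_hasCompactSupport ?_
  refine (hψs.fderiv ℝ).mono fun x hx => ?_
  rw [Function.mem_support] at hx ⊢
  contrapose! hx
  simp [hx]

end Divergence

/-- Integrating the energy of `exp (t u) φ` against the divergence structure, for a cutoff `φ`
whose gradient at `x` is `c x • x`. -/
lemma integral_energy_exp_mul {N : ℕ} {w u φ c : EuclideanSpace ℝ (Fin N) → ℝ} (t : ℝ)
    (hw : ContDiff ℝ 1 w) (hu : ContDiff ℝ 2 u) (hφ : ContDiff ℝ 1 φ) (hc : ContDiff ℝ 1 c)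
    (hφs : HasCompactSupport φ) (hφc : ∀ x v, fderiv ℝ φ x v = c x * ⟪x, v⟫) :
    ∃ F : EuclideanSpace ℝ (Fin N) → ℝ,
      (∀ x, F x = w x * exp (2 * t * u x) * c x ^ 2 * ‖x‖ ^ 2
        - t / 2 * (exp (2 * t * u x) * φ x ^ 2 * vdiv (fun y => w y • gradient u y) x)
        - 1 / 2 * exp (2 * t * u x) * (N * w x * (φ x * c x)
          + φ x * c x * ⟪gradient w x, x⟫ + w x * fderiv ℝ (fun y => φ y * c y) x x)) ∧
      Integrable F ∧
      ∫ x, w x * ‖gradient (fun y => exp (t * u y) * φ y) x‖ ^ 2 = ∫ x, F x := by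
  have hu1 : ContDiff ℝ 1 u := hu.of_le (by norm_num)
  have hgu := contDiff_one_gradient hu
  set ψ : EuclideanSpace ℝ (Fin N) → ℝ := fun y => exp (t * u y) * φ y with hψ
  set A : EuclideanSpace ℝ (Fin N) → ℝ := fun y => exp (2 * t * u y) * φ y ^ 2 with hA
  set B : EuclideanSpace ℝ (Fin N) → ℝ :=
    fun y => exp (2 * t * u y) * w y * (φ y * c y) with hB
  have hψ1 : ContDiff ℝ 1 ψ := by fun_prop
  have hA1 : ContDiff ℝ 1 A := by fun_prop
  have hB1 : ContDiff ℝ 1 B := by fun_prop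
  have hwg : ContDiff ℝ 1 fun y => w y • gradient u y := hw.smul hgu
  have hzero : ∀ f : EuclideanSpace ℝ (Fin N) → ℝ, (∀ x, φ x = 0 → f x = 0) →
      HasCompactSupport f := fun f hf => hφs.mono fun x hx hx' => hx (hf x hx')
  have hψs : HasCompactSupport ψ := hzero ψ fun x hx => by simp [hψ, hx]
  have hAs : HasCompactSupport A := hzero A fun x hx => by simp [hA, hx]
  have hBs : HasCompactSupport B := hzero B fun x hx => by simp [hB, hx]
  obtain ⟨i1, e1⟩ := integrable_integral_vdiv_eq_zero
    (V := fun y => A y • (w y • gradient u y)) (hA1.smul hwg) hAs.smul_right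
  obtain ⟨i2, e2⟩ := integrable_integral_vdiv_eq_zero
    (V := fun y => B y • y) (hB1.smul contDiff_id) hBs.smul_right
  have i0 : Integrable fun x => w x * ‖gradient ψ x‖ ^ 2 :=
    integrable_mul_norm_gradient_sq hw.continuous hψ1 hψs
  refine ⟨fun x => w x * ‖gradient ψ x‖ ^ 2
      - t / 2 * vdiv (fun y => A y • (w y • gradient u y)) x
      - 1 / 2 * vdiv (fun y => B y • y) x, ?_,
    (i0.sub (i1.const_mul _)).sub (i2.const_mul _), ?_⟩
  · intro x
    have du := (hu1.differentiable one_ne_zero x).hasFDerivAt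
    have dw := (hw.differentiable one_ne_zero x).hasFDerivAt
    have dφ := (hφ.differentiable one_ne_zero x).hasFDerivAt
    have dk := ((hφ.mul hc).differentiable one_ne_zero x).hasFDerivAt
    have gu : ∀ v, fderiv ℝ u x v = ⟪gradient u x, v⟫ := fun v => inner_gradient_left.symm
    have fψ : ∀ v, fderiv ℝ ψ x v
        = exp (t * u x) * (t * φ x * ⟪gradient u x, v⟫ + c x * ⟪x, v⟫) := by
      intro v
      have d : HasFDerivAt ψ _ x := (du.const_mul t).exp.mul dφ
      rw [d.fderiv]
      simp [hφc, inner_gradient_left]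
      ring
    have gψ : gradient ψ x = exp (t * u x) • ((t * φ x) • gradient u x + c x • x) := by
      refine ext_inner_right ℝ fun v => ?_
      rw [inner_gradient_left, fψ, real_inner_smul_left, inner_add_left, real_inner_smul_left,
        real_inner_smul_left]
    have fA : fderiv ℝ A x (w x • gradient u x) = exp (2 * t * u x) * w x *
        (2 * t * φ x ^ 2 * ‖gradient u x‖ ^ 2 + 2 * φ x * c x * ⟪gradient u x, x⟫) := by
      have d : HasFDerivAt A _ x := (du.const_mul (2 * t)).exp.mul (dφ.pow 2)
      rw [d.fderiv]
      simp only [add_apply, smul_apply, smul_eq_mul, map_smul,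
        hφc, gu, real_inner_comm (gradient u x) x, real_inner_self_eq_norm_sq, nsmul_eq_mul]
      push_cast
      ring
    have fB : fderiv ℝ B x x = exp (2 * t * u x) * (2 * t * ⟪gradient u x, x⟫ * w x * (φ x * c x)
        + φ x * c x * ⟪gradient w x, x⟫ + w x * fderiv ℝ (fun y => φ y * c y) x x) := by
      have d : HasFDerivAt B _ x := ((du.const_mul (2 * t)).exp.mul dw).mul dk
      rw [d.fderiv]
      simp [← inner_gradient_left]
      ring
    have hE : exp (2 * t * u x) = exp (t * u x) ^ 2 := by
      rw [← Real.exp_nat_mul]; congr 1; push_cast; ring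
    beta_reduce
    rw [vdiv_smul (hA1.differentiable one_ne_zero x)
      (hwg.differentiable one_ne_zero x),
      vdiv_smul (hB1.differentiable one_ne_zero x) differentiableAt_fun_id, vdiv_id, fA, fB, gψ,
      norm_smul, mul_pow, norm_add_sq_real, norm_smul, norm_smul, real_inner_smul_left,
      real_inner_smul_right]
    simp only [mul_pow, Real.norm_eq_abs, sq_abs, hA, hB, hE]
    ring
  · have h1 : Integrable fun x => t / 2 * vdiv (fun y => A y • (w y • gradient u y)) x :=
      i1.const_mul _
    have h2 : Integrable fun x => 1 / 2 * vdiv (fun y => B y • y) x := i2.const_mul _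
    have h3 : Integrable fun x => w x * ‖gradient ψ x‖ ^ 2
      - t / 2 * vdiv (fun y => A y • (w y • gradient u y)) x := i0.sub h1
    rw [integral_sub h3 h2, integral_sub i0 h1, integral_const_mul, integral_const_mul, e1, e2]
    simp

lemma exists_cutoff_profile : ∃ g : ℝ → ℝ, ContDiff ℝ 3 g ∧ (∀ s, 0 ≤ g s) ∧ (∀ s, g s ≤ 1) ∧
    (∀ s ≤ 2, g s = 1) ∧ (∀ s, 3 ≤ s → g s = 0) ∧ ∀ s, deriv g s ≤ 0 := by
  refine ⟨fun s => smoothTransition (3 - s), ?_, fun s => smoothTransition.nonneg _,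
    fun s => smoothTransition.le_one _, fun s hs => smoothTransition.one_of_one_le (by linarith),
    fun s hs => smoothTransition.zero_of_nonpos (by linarith), fun s => ?_⟩
  · exact (smoothTransition.contDiff (n := 3)).comp (contDiff_const.sub contDiff_id)
  · have : Antitone fun s : ℝ => smoothTransition (3 - s) := fun a b hab =>
      smoothTransition.monotone (by linarith)
    exact this.deriv_nonpos

lemma fderiv_comp_norm_sq_div {N : ℕ} {f : ℝ → ℝ} (hf : Differentiable ℝ f) (r : ℝ)
    (x v : EuclideanSpace ℝ (Fin N)) :
    fderiv ℝ (fun y => f (‖y‖ ^ 2 / r)) x v = deriv f (‖x‖ ^ 2 / r) * (2 / r) * ⟪x, v⟫ := by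
  have h1 : HasFDerivAt (fun y : EuclideanSpace ℝ (Fin N) => ‖y‖ ^ 2 * r⁻¹) _ x :=
    (hasStrictFDerivAt_norm_sq x).hasFDerivAt.mul_const r⁻¹
  have h2 := (hf (‖x‖ ^ 2 * r⁻¹)).hasDerivAt.comp_hasFDerivAt x h1
  simp only [div_eq_mul_inv]
  have h3 : HasFDerivAt (fun y : EuclideanSpace ℝ (Fin N) => f (‖y‖ ^ 2 * r⁻¹)) _ x := h2
  rw [h3.fderiv]
  simp
  ring

/-- Radial cutoffs `g ^ 5` equal to `1` on the ball of radius `R` and vanishing outside the ball of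
radius `2 R`, with the derivative bounds used in the capacity estimate. -/
lemma exists_radial_cutoff (N : ℕ) : ∃ K : ℝ, 0 ≤ K ∧ ∀ R : ℝ, 0 < R →
    ∃ g c : EuclideanSpace ℝ (Fin N) → ℝ,
      ContDiff ℝ 2 g ∧ ContDiff ℝ 1 c ∧ HasCompactSupport g ∧
      (∀ x, 0 ≤ g x) ∧ (∀ x, g x ≤ 1) ∧ (∀ x, ‖x‖ ≤ R → g x = 1) ∧
      (∀ x, c x ≤ 0) ∧ (∀ x, ‖x‖ ≤ R → c x = 0) ∧
      (∀ x v, fderiv ℝ (fun y => g y ^ 5) x v = c x * ⟪x, v⟫) ∧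
      (∀ x, x ∉ annulus N R → c x ^ 2 * ‖x‖ ^ 2 - 1 / 2 * (N * (g x ^ 5 * c x)
        + fderiv ℝ (fun y => g y ^ 5 * c y) x x) ≤ 0) ∧
      (∀ x, c x ^ 2 * ‖x‖ ^ 2 - 1 / 2 * (N * (g x ^ 5 * c x)
        + fderiv ℝ (fun y => g y ^ 5 * c y) x x) ≤ K / R ^ 2 * g x ^ 8) := by
  obtain ⟨g, hg, hg0, hg1, hgl, hgr, hgd⟩ := exists_cutoff_profile
  have hd : ContDiff ℝ 2 (deriv g) := ((contDiff_succ_iff_deriv (n := 2)).1 hg).2.2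
  have hdd : ContDiff ℝ 1 (deriv (deriv g)) := ((contDiff_succ_iff_deriv (n := 1)).1 hd).2.2
  have hdl : ∀ s < 2, deriv g s = 0 := fun s hs => by
    have : g =ᶠ[nhds s] fun _ => 1 := by
      filter_upwards [Iio_mem_nhds hs] with y hy using hgl y (le_of_lt hy)
    rw [this.deriv_eq, deriv_const]
  have hddl : ∀ s < 2, deriv (deriv g) s = 0 := fun s hs => by
    have : deriv g =ᶠ[nhds s] fun _ => 0 := by
      filter_upwards [Iio_mem_nhds hs] with y hy using hdl y hy
    rw [this.deriv_eq, deriv_const]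
  set H : ℝ → ℝ := fun s => 10 * s * deriv g s ^ 2 - 5 * N * (g s * deriv g s)
    - 10 * s * (g s * deriv (deriv g) s) with hH
  have hHc : Continuous H := by
    have := hg.continuous
    have := hd.continuous
    have := hdd.continuous
    fun_prop
  obtain ⟨K, hK⟩ := (isCompact_Icc (a := (0 : ℝ)) (b := 4)).bddAbove_image hHc.continuousOn
  have hK' : ∀ s ∈ Set.Icc (0 : ℝ) 4, H s ≤ K := fun s hs => hK ⟨s, hs, rfl⟩
  refine ⟨max K 0, le_max_right _ _, fun R hR => ?_⟩
  have hR2 : 0 < R ^ 2 := by positivity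
  set p : ℝ → ℝ := fun s => g s ^ 5 with hp
  set q : ℝ → ℝ := fun s => 5 * g s ^ 4 * deriv g s * (2 / R ^ 2) with hq
  have hsx : ContDiff ℝ 2 fun x : EuclideanSpace ℝ (Fin N) => ‖x‖ ^ 2 / R ^ 2 :=
    (contDiff_norm_sq ℝ).div_const _
  have hg2 : ContDiff ℝ 2 g := hg.of_le (by norm_num)
  have hq1 : ContDiff ℝ 2 q := by fun_prop
  have hgdiff : Differentiable ℝ g := hg.differentiable (by norm_num)
  have hddiff : Differentiable ℝ (deriv g) := hd.differentiable (by norm_num)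
  have hs0 : ∀ x : EuclideanSpace ℝ (Fin N), 0 ≤ ‖x‖ ^ 2 / R ^ 2 := fun x => by positivity
  have hsl : ∀ x : EuclideanSpace ℝ (Fin N), ‖x‖ ≤ R → ‖x‖ ^ 2 / R ^ 2 ≤ 1 := fun x hx => by
    rw [div_le_one hR2]
    gcongr
  have hsr : ∀ x : EuclideanSpace ℝ (Fin N), 2 * R ≤ ‖x‖ → 4 ≤ ‖x‖ ^ 2 / R ^ 2 := fun x hx => by
    rw [le_div_iff₀ hR2]
    nlinarith
  have hkey : ∀ x : EuclideanSpace ℝ (Fin N),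
      q (‖x‖ ^ 2 / R ^ 2) ^ 2 * ‖x‖ ^ 2 - 1 / 2 * (N * (p (‖x‖ ^ 2 / R ^ 2) * q (‖x‖ ^ 2 / R ^ 2))
        + fderiv ℝ (fun y => p (‖y‖ ^ 2 / R ^ 2) * q (‖y‖ ^ 2 / R ^ 2)) x x)
        = H (‖x‖ ^ 2 / R ^ 2) / R ^ 2 * g (‖x‖ ^ 2 / R ^ 2) ^ 8 := by
    intro x
    have hpq : Differentiable ℝ fun s => p s * q s := by fun_prop
    rw [fderiv_comp_norm_sq_div hpq (R ^ 2) x x, real_inner_self_eq_norm_sq]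
    have hder : ∀ s, deriv (fun s => p s * q s) s
        = (10 / R ^ 2) * (9 * g s ^ 8 * deriv g s ^ 2 + g s ^ 9 * deriv (deriv g) s) := by
      intro s
      have h1 := (hgdiff s).hasDerivAt
      have h2 := (hddiff s).hasDerivAt
      have h3 : HasDerivAt (fun s => p s * q s) _ s :=
        (h1.pow 5).mul ((((h1.pow 4).const_mul 5).mul h2).mul_const (2 / R ^ 2))
      rw [h3.deriv]
      simp
      ring
    rw [hder]
    obtain ⟨s, hs⟩ : ∃ s, s = ‖x‖ ^ 2 / R ^ 2 := ⟨_, rfl⟩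
    have hx : ‖x‖ ^ 2 = s * R ^ 2 := by rw [hs]; field_simp
    rw [← hs, hx]
    simp only [hH, hp, hq]
    field_simp
    ring
  refine ⟨fun x => g (‖x‖ ^ 2 / R ^ 2), fun x => q (‖x‖ ^ 2 / R ^ 2), hg2.comp hsx,
    (hq1.comp hsx).of_le (by norm_num), ?_, fun x => hg0 _, fun x => hg1 _,
    fun x hx => hgl _ (by linarith [hsl x hx]), fun x => ?_, fun x hx => ?_, fun x v => ?_,
    fun x hx => ?_, fun x => ?_⟩
  · refine HasCompactSupport.intro (isCompact_closedBall 0 (2 * R)) fun x hx => hgr _ ?_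
    rw [mem_closedBall_zero_iff, not_le] at hx
    linarith [hsr x hx.le]
  · exact mul_nonpos_of_nonpos_of_nonneg (mul_nonpos_of_nonneg_of_nonpos
      (by have := hg0 (‖x‖ ^ 2 / R ^ 2); positivity) (hgd _)) (by positivity)
  · simp [hq, hdl (‖x‖ ^ 2 / R ^ 2) (by linarith [hsl x hx])]
  · have h5 : Differentiable ℝ p := by fun_prop
    rw [fderiv_comp_norm_sq_div h5 (R ^ 2) x v]
    have h3 : HasDerivAt p _ (‖x‖ ^ 2 / R ^ 2) := ((hgdiff _).hasDerivAt.pow 5)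
    rw [h3.deriv]
    simp [hq]
  · refine (hkey x).trans_le (le_of_eq ?_)
    by_cases h : ‖x‖ ≤ R
    · have h1 := hdl (‖x‖ ^ 2 / R ^ 2) (by linarith [hsl x h])
      have h2 := hddl (‖x‖ ^ 2 / R ^ 2) (by linarith [hsl x h])
      simp [hH, h1, h2]
    · have h' : 2 * R ≤ ‖x‖ := by
        by_contra! h2
        exact hx ⟨not_le.1 h, h2⟩
      simp [hgr (‖x‖ ^ 2 / R ^ 2) (by linarith [hsr x h'])]
  · refine (hkey x).trans_le ?_
    by_cases h : ‖x‖ ^ 2 / R ^ 2 ≤ 4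
    · have h1 : H (‖x‖ ^ 2 / R ^ 2) ≤ max K 0 := (hK' _ ⟨hs0 x, h⟩).trans (le_max_left _ _)
      have := hg0 (‖x‖ ^ 2 / R ^ 2)
      gcongr
    · simp [hgr (‖x‖ ^ 2 / R ^ 2) (by linarith)]

/-- A Young-type inequality with the powers of the cutoff `g` adapted to exponents `t < 2`. -/
lemma mul_rpow_mul_pow_le {a b y g t : ℝ} (ha : 0 ≤ a) (hb : 0 < b) (hy : 0 < y) (hg0 : 0 ≤ g)
    (hg1 : g ≤ 1) (ht0 : 0 < t) (ht2 : t < 2) :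
    a * y ^ (2 * t) * g ^ 8 ≤ b * y * y ^ (2 * t) * g ^ 10 + a ^ (2 * t + 1) / b ^ (2 * t) := by
  have hyt : 0 ≤ y ^ (2 * t) := by positivity
  have hr : 0 ≤ a ^ (2 * t + 1) / b ^ (2 * t) := by positivity
  have hl : 0 ≤ b * y * y ^ (2 * t) * g ^ 10 := by positivity
  by_cases h : a ≤ b * y * g ^ 2
  · have : a * (y ^ (2 * t) * g ^ 8) ≤ b * y * g ^ 2 * (y ^ (2 * t) * g ^ 8) := by gcongr
    nlinarith
  · have h1 : y * g ^ 2 ≤ a / b := by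
      rw [le_div_iff₀ hb]
      nlinarith
    have h2 : g ^ 8 ≤ (g ^ 2) ^ (2 * t) := by
      rcases hg0.eq_or_lt with h0 | h0
      · rw [← h0]
        simpa using Real.rpow_nonneg (by norm_num) _
      · have : g ^ 8 = (g ^ 2) ^ (4 : ℝ) := by
          rw [show (4 : ℝ) = ((4 : ℕ) : ℝ) by norm_num, Real.rpow_natCast, ← pow_mul]
        rw [this]
        exact Real.rpow_le_rpow_of_exponent_ge (by positivity) (by nlinarith) (by linarith)
    have h3 : y ^ (2 * t) * g ^ 8 ≤ (a / b) ^ (2 * t) := by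
      calc y ^ (2 * t) * g ^ 8 ≤ y ^ (2 * t) * (g ^ 2) ^ (2 * t) := by gcongr
        _ = (y * g ^ 2) ^ (2 * t) := (Real.mul_rpow hy.le (by positivity)).symm
        _ ≤ (a / b) ^ (2 * t) := Real.rpow_le_rpow (by positivity) h1 (by linarith)
    have h4 : a * (a / b) ^ (2 * t) = a ^ (2 * t + 1) / b ^ (2 * t) := by
      rw [Real.div_rpow ha hb.le, Real.rpow_add_one' ha (by linarith)]
      ring
    calc a * y ^ (2 * t) * g ^ 8 = a * (y ^ (2 * t) * g ^ 8) := by ring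
      _ ≤ a * (a / b) ^ (2 * t) := by gcongr
      _ ≤ _ := by rw [h4]; linarith

lemma integrableOn_annulus {N : ℕ} {f : EuclideanSpace ℝ (Fin N) → ℝ} (hf : Continuous f) (R : ℝ) :
    IntegrableOn f (annulus N R) := by
  refine (hf.continuousOn.integrableOn_compact
    (isCompact_closedBall (0 : EuclideanSpace ℝ (Fin N)) (2 * R))).mono_set fun x hx => ?_
  rw [mem_closedBall_zero_iff]
  exact hx.2.le

lemma measurableSet_annulus (N : ℕ) (R : ℝ) : MeasurableSet (annulus N R) :=
  (measurableSet_lt measurable_const measurable_norm).inter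
    (measurableSet_lt measurable_norm measurable_const)

theorem stmt_4 (N : ℕ) (hN : 1 ≤ N)
    (ω₁ ω₂ : EuclideanSpace ℝ (Fin N) → ℝ)
    (hω₁ : ContDiff ℝ (⊤ : ℕ∞) ω₁) (hω₂ : ContDiff ℝ (⊤ : ℕ∞) ω₂)
    (hω₁pos : ∀ x, 0 < ω₁ x) (hω₂pos : ∀ x, 0 < ω₂ x)
    (hmono : ∃ R₀ : ℝ, ∀ x : EuclideanSpace ℝ (Fin N), R₀ ≤ ‖x‖ → ⟪gradient ω₁ x, x⟫ ≤ 0)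
    (t : ℝ) (ht0 : 0 < t) (ht2 : t < 2)
    (hIG : Tendsto (fun R : ℝ =>
      R ^ (-4*t - 2) * ∫ x in annulus N R, ω₁ x ^ (2*t + 1) / ω₂ x ^ (2*t))
      atTop (nhds 0)) :
    ¬ ∃ u : EuclideanSpace ℝ (Fin N) → ℝ, ContDiff ℝ 2 u ∧
      (∀ x, -vdiv (fun y => ω₁ y • gradient u y) x ≤ ω₂ x * Real.exp (u x)) ∧
      (∀ ψ : EuclideanSpace ℝ (Fin N) → ℝ, ContDiff ℝ 2 ψ → HasCompactSupport ψ →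
        ∫ x, ω₂ x * Real.exp (u x) * ψ x ^ 2 ≤ ∫ x, ω₁ x * ‖gradient ψ x‖ ^ 2) := by
  rintro ⟨u, hu, hsub, hstab⟩
  obtain ⟨R₀, hR₀⟩ := hmono
  obtain ⟨K, hK0, hK⟩ := exists_radial_cutoff N
  have hω₁1 : ContDiff ℝ 1 ω₁ := hω₁.of_le (by exact_mod_cast le_top)
  have hω₂c : Continuous ω₂ := hω₂.continuous
  have huc : Continuous u := hu.continuous
  set f : EuclideanSpace ℝ (Fin N) → ℝ := fun x => ω₂ x * exp (u x) * exp (2 * t * u x) with hf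
  have hfc : Continuous f := by fun_prop
  have hfpos : ∀ x, 0 < f x := fun x => by have := hω₂pos x; positivity
  set h : EuclideanSpace ℝ (Fin N) → ℝ := fun x => ω₁ x ^ (2 * t + 1) / ω₂ x ^ (2 * t) with hh
  have hhc : Continuous h :=
    (hω₁1.continuous.rpow_const fun x => Or.inl (hω₁pos x).ne').div
      (hω₂c.rpow_const fun x => Or.inl (hω₂pos x).ne')
      fun x => (Real.rpow_pos_of_pos (hω₂pos x) _).ne'
  set ε : ℝ := (2 - t) / 4 with hε
  have hε0 : 0 < ε := by rw [hε]; linarith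
  set M : ℝ := K ^ (2 * t + 1) / ε ^ (2 * t) with hM
  have hM0 : 0 ≤ M := by positivity
  set c₀ : ℝ := ∫ x in Metric.closedBall 0 1, f x with hc₀
  have hc₀pos : 0 < c₀ := by
    have hi : IntegrableOn f (Metric.closedBall 0 1) :=
      hfc.continuousOn.integrableOn_compact (isCompact_closedBall _ _)
    rw [hc₀, setIntegral_pos_iff_support_of_nonneg_ae (ae_of_all _ fun x => (hfpos x).le) hi]
    have : Function.support f = Set.univ := Set.eq_univ_of_forall fun x => (hfpos x).ne'
    rw [this, Set.univ_inter]
    exact Metric.measure_closedBall_pos _ _ one_pos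
  have hmain : ∀ R : ℝ, 1 ≤ R → R₀ ≤ R →
      ε * c₀ ≤ M * (R ^ (-4 * t - 2) * ∫ x in annulus N R, h x) := by
    intro R hR1 hR
    have hRpos : 0 < R := by linarith
    obtain ⟨g, c, hg, hc, hgs, hg0, hg1, hgone, hc0, hcz, hgc, hout, hin⟩ := hK R hRpos
    have hg5 : ContDiff ℝ 2 fun y => g y ^ 5 := hg.pow 5
    have hsupp : ∀ k : EuclideanSpace ℝ (Fin N) → ℝ, (∀ x, g x = 0 → k x = 0) →
      HasCompactSupport k := fun k hk => hgs.mono fun x hx hx' => hx (hk x hx')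
    obtain ⟨F, hF, hFi, hFint⟩ := integral_energy_exp_mul t hω₁1 hu (hg5.of_le (by norm_num)) hc
      (hsupp _ fun x hx => by simp [hx]) hgc
    have hψ := hstab (fun y => exp (t * u y) * g y ^ 5) (((contDiff_const.mul hu).exp).mul hg5)
      (hsupp _ fun x hx => by simp [hx])
    have hE : ∀ x, exp (2 * t * u x) = exp (t * u x) ^ 2 := fun x => by
      rw [← Real.exp_nat_mul]; congr 1; push_cast; ring
    have hJeq : ∀ x, ω₂ x * exp (u x) * (exp (t * u x) * g x ^ 5) ^ 2 = f x * g x ^ 10 := by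
      intro x
      simp only [hf, hE]
      ring
    simp only [hJeq] at hψ
    rw [hFint] at hψ
    have hJi : Integrable fun x => f x * g x ^ 10 :=
      (hfc.mul (hg.continuous.pow 10)).integrable_of_hasCompactSupport
        (hsupp _ fun x hx => by simp [hx])
    have hpt : ∀ x, F x ≤ (t / 2 + ε) * (f x * g x ^ 10)
        + M * R ^ (-4 * t - 2) * (annulus N R).indicator h x := by
      intro x
      have hw := hω₁pos x
      have hv := hω₂pos x
      have hsubx : -(t / 2 * (exp (2 * t * u x) * (g x ^ 5) ^ 2
          * vdiv (fun y => ω₁ y • gradient u y) x)) ≤ t / 2 * (f x * g x ^ 10) := by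
        have := mul_le_mul_of_nonneg_left (hsub x)
          (show 0 ≤ t / 2 * (exp (2 * t * u x) * (g x ^ 5) ^ 2) by positivity)
        simp only [hf]
        linarith
      have hmonx : 0 ≤ g x ^ 5 * c x * ⟪gradient ω₁ x, x⟫ := by
        by_cases hx : ‖x‖ ≤ R
        · simp [hcz x hx]
        · exact mul_nonneg_of_nonpos_of_nonpos
            (mul_nonpos_of_nonneg_of_nonpos (pow_nonneg (hg0 x) 5) (hc0 x))
            (hR₀ x (by linarith))
      have hmonx' : 0 ≤ 1 / 2 * exp (2 * t * u x) * (g x ^ 5 * c x * ⟪gradient ω₁ x, x⟫) := by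
        positivity
      have hrest : ω₁ x * exp (2 * t * u x) * (c x ^ 2 * ‖x‖ ^ 2 - 1 / 2 * (N * (g x ^ 5 * c x)
          + fderiv ℝ (fun y => g y ^ 5 * c y) x x))
          ≤ ε * (f x * g x ^ 10)
            + M * R ^ (-4 * t - 2) * (annulus N R).indicator h x := by
        by_cases hx : x ∈ annulus N R
        · have hy := mul_rpow_mul_pow_le (a := K / R ^ 2 * ω₁ x) (b := ε * ω₂ x) (y := exp (u x))
            (by positivity) (by positivity) (exp_pos _) (hg0 x) (hg1 x) ht0 ht2
          have hexp : exp (u x) ^ (2 * t) = exp (2 * t * u x) := by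
            rw [← Real.exp_mul]; ring_nf
          have hR' : (R ^ 2) ^ (2 * t + 1) = (R ^ (-4 * t - 2))⁻¹ := by
            rw [← Real.rpow_neg hRpos.le, ← Real.rpow_natCast, ← Real.rpow_mul hRpos.le]
            congr 1
            push_cast
            ring
          have hconst : (K / R ^ 2 * ω₁ x) ^ (2 * t + 1) / (ε * ω₂ x) ^ (2 * t)
              = M * R ^ (-4 * t - 2) * h x := by
            rw [Real.mul_rpow (by positivity) hw.le, Real.div_rpow hK0 (by positivity),
              Real.mul_rpow hε0.le hv.le, hR']
            simp only [hM, hh, div_inv_eq_mul]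
            ring
          rw [hexp, hconst] at hy
          rw [Set.indicator_of_mem hx]
          have := mul_le_mul_of_nonneg_left (hin x)
            (show 0 ≤ ω₁ x * exp (2 * t * u x) by positivity)
          refine this.trans (le_of_eq_of_le ?_ (hy.trans_eq ?_))
          · ring
          · simp only [hf]
            ring
        · rw [Set.indicator_of_notMem hx]
          have h1 := mul_nonpos_of_nonneg_of_nonpos
            (show 0 ≤ ω₁ x * exp (2 * t * u x) by positivity) (hout x hx)
          have h2 : 0 ≤ ε * (f x * g x ^ 10) := by
            have := hfpos x
            have := hg0 x
            positivity
          linarith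
      rw [hF x]
      linarith
    have hind : Integrable ((annulus N R).indicator h) :=
      (integrable_indicator_iff (measurableSet_annulus N R)).2 (integrableOn_annulus hhc R)
    have hFle := integral_mono hFi ((hJi.const_mul (t / 2 + ε)).add
      (hind.const_mul (M * R ^ (-4 * t - 2)))) hpt
    simp only [Pi.add_apply] at hFle
    rw [integral_add (hJi.const_mul _) (hind.const_mul _), integral_const_mul, integral_const_mul,
      integral_indicator (measurableSet_annulus N R)] at hFle
    have hlow : c₀ ≤ ∫ x, f x * g x ^ 10 := by
      have heq : c₀ = ∫ x in Metric.closedBall 0 1, f x * g x ^ 10 := by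
        refine setIntegral_congr_fun measurableSet_closedBall fun x hx => ?_
        rw [mem_closedBall_zero_iff] at hx
        simp [hgone x (hx.trans hR1)]
      rw [heq]
      refine setIntegral_le_integral hJi (ae_of_all _ fun x => ?_)
      exact mul_nonneg (hfpos x).le (pow_nonneg (hg0 x) 10)
    have h1 : t / 2 + ε = 1 - ε := by rw [hε]; ring
    rw [h1] at hFle
    have h2 := mul_le_mul_of_nonneg_left hlow hε0.le
    linarith
  have hlim := hIG.const_mul M
  rw [mul_zero] at hlim
  have := ge_of_tendsto hlim (b := ε * c₀) (by
    filter_upwards [eventually_ge_atTop 1, eventually_ge_atTop R₀] with R h1 h2 using hmain R h1 h2)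
  nlinarith [mul_pos hε0 hc₀pos]
end
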